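/- For every lower semilinear diagonal δ ∈ 𝒟^LSL, Chatterjee's rank correlation never exceeds Spearman's footrule: ξ(δ) ≤ φ(δ). -/

import Mathlib

open MeasureTheory Set

/-- A lower semilinear diagonal: nondecreasing, 2-Lipschitz on `[0,1]`, `δ 1 = 1`,
`t² ≤ δ t ≤ t` on `[0,1]`, `t ↦ δ t / t` nondecreasing on `(0,1]` and
`t ↦ δ t / t²` nonincreasing on `(0,1]`. -/
def IsLSL (δ : ℝ → ℝ) : Prop :=
  MonotoneOn δ (Icc 0 1) ∧
  LipschitzOnWith 2 δ (Icc 0 1) ∧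
  δ 1 = 1 ∧
  (∀ t ∈ Icc (0:ℝ) 1, t ^ 2 ≤ δ t ∧ δ t ≤ t) ∧
  MonotoneOn (fun t => δ t / t) (Ioc 0 1) ∧
  AntitoneOn (fun t => δ t / t ^ 2) (Ioc 0 1)

/-- Kendall's tau of the lower semilinear copula with diagonal `δ`. -/
noncomputable def tauLSL (δ : ℝ → ℝ) : ℝ := 4 * (∫ t in (0:ℝ)..1, (δ t) ^ 2 / t) - 1

/-- Spearman's rho of the lower semilinear copula with diagonal `δ`. -/
noncomputable def rhoLSL (δ : ℝ → ℝ) : ℝ := 12 * (∫ t in (0:ℝ)..1, t * δ t) - 3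

/-- Spearman's footrule of the lower semilinear copula with diagonal `δ`. -/
noncomputable def phiLSL (δ : ℝ → ℝ) : ℝ := 6 * (∫ t in (0:ℝ)..1, δ t) - 2

/-- Chatterjee's rank correlation of the lower semilinear copula with diagonal `δ`,
expressed through the a.e. derivative of `δ` (represented by `deriv δ`, which agrees
with the a.e. derivative almost everywhere since `δ` is Lipschitz on `[0,1]`). -/
noncomputable def xiLSL (δ : ℝ → ℝ) : ℝ :=
  tauLSL δ - 2 * ∫ t in (0:ℝ)..1,
    (t * deriv δ t - δ t) * (2 * δ t - t * deriv δ t) / t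

/-- The diagonal `u_a`: `u_a t = t²/a` for `t ≤ a`, `u_a t = t` otherwise (`u_0 t = t`). -/
noncomputable def uDiag (a : ℝ) (t : ℝ) : ℝ :=
  if a = 0 then t else if t ≤ a then t ^ 2 / a else t

/-- The diagonal `l_a`: `l_a t = a·t` for `t ≤ a`, `l_a t = t²` otherwise. -/
noncomputable def lDiag (a : ℝ) (t : ℝ) : ℝ := if t ≤ a then a * t else t ^ 2

theorem MonotoneOn.nonneg_of_hasDerivAt {f : ℝ → ℝ} {s : Set ℝ} {x d : ℝ} (hf : MonotoneOn f s)
    (hs : IsOpen s) (hx : x ∈ s) (hd : HasDerivAt f d x) : 0 ≤ d := by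
  rw [← hd.hasDerivWithinAt.derivWithin (hs.uniqueDiffWithinAt hx)]
  exact hf.derivWithin_nonneg

theorem AntitoneOn.nonpos_of_hasDerivAt {f : ℝ → ℝ} {s : Set ℝ} {x d : ℝ} (hf : AntitoneOn f s)
    (hs : IsOpen s) (hx : x ∈ s) (hd : HasDerivAt f d x) : d ≤ 0 := by
  rw [← hd.hasDerivWithinAt.derivWithin (hs.uniqueDiffWithinAt hx)]
  exact hf.derivWithin_nonpos

namespace IsLSL

variable {δ : ℝ → ℝ}

theorem le_mul_deriv (hδ : IsLSL δ) {t d : ℝ} (ht : t ∈ Ioo (0:ℝ) 1) (hd : HasDerivAt δ d t) :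
    δ t ≤ t * d := by
  have h := (hδ.2.2.2.2.1.mono Ioo_subset_Ioc_self).nonneg_of_hasDerivAt isOpen_Ioo ht
    (hd.div (hasDerivAt_id t) ht.1.ne')
  have h2 := (le_div_iff₀ (by have := ht.1; positivity)).1 h
  linarith

theorem mul_deriv_le (hδ : IsLSL δ) {t d : ℝ} (ht : t ∈ Ioo (0:ℝ) 1) (hd : HasDerivAt δ d t) :
    t * d ≤ 2 * δ t := by
  have ht0 := ht.1
  have h := (hδ.2.2.2.2.2.mono Ioo_subset_Ioc_self).nonpos_of_hasDerivAt isOpen_Ioo ht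
    (hd.div (hasDerivAt_pow 2 t) (by positivity))
  have h2 := (div_le_iff₀ (by positivity)).1 h
  norm_num at h2
  nlinarith

theorem absolutelyContinuousOnInterval (hδ : IsLSL δ) :
    AbsolutelyContinuousOnInterval δ 0 1 :=
  LipschitzOnWith.absolutelyContinuousOnInterval (K := 2)
    (by rw [uIcc_of_le zero_le_one]; exact hδ.2.1)

theorem ae_differentiableAt (hδ : IsLSL δ) :
    ∀ᵐ t : ℝ, t ∈ Icc (0:ℝ) 1 → DifferentiableAt ℝ δ t := by
  simpa only [uIcc_of_le (zero_le_one' ℝ)] using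
    hδ.absolutelyContinuousOnInterval.ae_differentiableAt

theorem intervalIntegrable (hδ : IsLSL δ) : IntervalIntegrable δ volume 0 1 :=
  MonotoneOn.intervalIntegrable (by rw [uIcc_of_le zero_le_one]; exact hδ.1)

theorem intervalIntegrable_sq_div (hδ : IsLSL δ) :
    IntervalIntegrable (fun t => δ t ^ 2 / t) volume 0 1 := by
  refine MonotoneOn.intervalIntegrable ?_
  rw [uIcc_of_le zero_le_one]
  intro x hx y hy hxy
  have hb := hδ.2.2.2.1
  rcases hx.1.eq_or_lt with rfl | hx0
  · have := hy.1
    simp only [div_zero]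
    positivity
  · have hy0 : 0 < y := hx0.trans_le hxy
    have h1 := hδ.1 hx hy hxy
    have h2 : δ x / x ≤ δ y / y := hδ.2.2.2.2.1 ⟨hx0, hx.2⟩ ⟨hy0, hy.2⟩ hxy
    have hx' : 0 ≤ δ x := (sq_nonneg x).trans (hb x hx).1
    have hy' : 0 ≤ δ y := hx'.trans h1
    calc δ x ^ 2 / x = δ x * (δ x / x) := by ring
      _ ≤ δ y * (δ y / y) := by gcongr
      _ = δ y ^ 2 / y := by ring

theorem xiLSL_le_tauLSL (hδ : IsLSL δ) : xiLSL δ ≤ tauLSL δ := by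
  have h : 0 ≤ ∫ t in (0:ℝ)..1, (t * deriv δ t - δ t) * (2 * δ t - t * deriv δ t) / t := by
    refine intervalIntegral.integral_nonneg_of_ae_restrict zero_le_one ?_
    rw [Filter.EventuallyLE, ← Measure.restrict_congr_set Ioo_ae_eq_Icc,
      ae_restrict_iff' measurableSet_Ioo]
    filter_upwards [hδ.ae_differentiableAt] with t hd ht
    have hd := (hd (Ioo_subset_Icc_self ht)).hasDerivAt
    exact div_nonneg (mul_nonneg (sub_nonneg.2 (hδ.le_mul_deriv ht hd))
      (sub_nonneg.2 (hδ.mul_deriv_le ht hd))) ht.1.le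
  unfold xiLSL
  linarith

/-- The point at which `δ t / t` crosses `3 / 4`, encoded through the ratio `k = (t² / δ t)²`
there. -/
theorem exists_crossing (hδ : IsLSL δ) {ε : ℝ} (hε : 0 < ε) (hε1 : ε ≤ 1) :
    ∃ k : ℝ, 0 ≤ k ∧ ∀ t ∈ Icc ε 1, 0 ≤ (4 * (δ t / t) - 3) * (t ^ 2 - k * (δ t / t) ^ 2) := by
  have hmem : ∀ t ∈ Icc ε 1, t ∈ Ioc (0:ℝ) 1 := fun t ht => ⟨hε.trans_le ht.1, ht.2⟩
  have hpos : ∀ t ∈ Icc ε 1, 0 < δ t := fun t ht =>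
    (pow_pos (hmem t ht).1 2).trans_le (hδ.2.2.2.1 t (Ioc_subset_Icc_self (hmem t ht))).1
  obtain ⟨c, hc, hlow, hhigh⟩ : ∃ c ∈ Icc ε 1, (∀ t ∈ Icc ε 1, t < c → δ t / t ≤ 3 / 4) ∧
      ∀ t ∈ Icc ε 1, c ≤ t → 3 / 4 ≤ δ t / t := by
    by_cases h : 3 / 4 ≤ δ ε / ε
    · refine ⟨ε, ⟨le_rfl, hε1⟩, fun t ht htc => absurd ht.1 htc.not_ge, fun t ht _ => ?_⟩
      exact h.trans (hδ.2.2.2.2.1 (hmem ε ⟨le_rfl, hε1⟩) (hmem t ht) ht.1)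
    · have hcont : ContinuousOn (fun t => δ t / t) (Icc ε 1) :=
        (hδ.2.1.continuousOn.mono (Icc_subset_Icc_left hε.le)).div continuousOn_id
          fun t ht => (hmem t ht).1.ne'
      obtain ⟨c, hc, hgc⟩ : (3 / 4 : ℝ) ∈ (fun t => δ t / t) '' Icc ε 1 :=
        intermediate_value_Icc hε1 hcont ⟨(not_le.1 h).le, by
          simp only [hδ.2.2.1]
          norm_num⟩
      refine ⟨c, hc, fun t ht htc => ?_, fun t ht htc => ?_⟩
      · exact (hδ.2.2.2.2.1 (hmem t ht) (hmem c hc) htc.le).trans_eq hgc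
      · exact hgc.symm.trans_le (hδ.2.2.2.2.1 (hmem c hc) (hmem t ht) htc)
  have hratio : ∀ x ∈ Icc ε 1, ∀ y ∈ Icc ε 1, x ≤ y → x ^ 2 / δ x ≤ y ^ 2 / δ y := by
    intro x hx y hy hxy
    have h : δ y / y ^ 2 ≤ δ x / x ^ 2 := hδ.2.2.2.2.2 (hmem x hx) (hmem y hy) hxy
    have := hpos y hy
    have := (hmem y hy).1
    simpa only [inv_div] using inv_anti₀ (by positivity) h
  have hfac : ∀ t ∈ Icc ε 1, t ^ 2 - (c ^ 2 / δ c) ^ 2 * (δ t / t) ^ 2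
      = (δ t / t) ^ 2 * ((t ^ 2 / δ t) ^ 2 - (c ^ 2 / δ c) ^ 2) := by
    intro t ht
    have := (hpos t ht).ne'
    have := (hpos c hc).ne'
    have := (hmem t ht).1.ne'
    field_simp
  have hnn : ∀ t ∈ Icc ε 1, 0 ≤ t ^ 2 / δ t := fun t ht => by
    have := hpos t ht
    positivity
  refine ⟨(c ^ 2 / δ c) ^ 2, by positivity, fun t ht => ?_⟩
  rw [hfac t ht]
  rcases lt_or_ge t c with htc | htc
  · refine mul_nonneg_of_nonpos_of_nonpos (by linarith [hlow t ht htc])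
      (mul_nonpos_of_nonneg_of_nonpos (by positivity) (sub_nonpos.2 ?_))
    exact pow_le_pow_left₀ (hnn t ht) (hratio t ht c hc htc.le) 2
  · refine mul_nonneg (by linarith [hhigh t ht htc])
      (mul_nonneg (by positivity) (sub_nonneg.2 ?_))
    exact pow_le_pow_left₀ (hnn c hc) (hratio c hc t ht htc) 2

theorem integral_le_sq (hδ : IsLSL δ) {ε : ℝ} (hε : 0 < ε) (hε1 : ε ≤ 1) :
    ∫ t in ε..1, (2 * (δ t ^ 2 / t) - 3 * δ t + t) ≤ ε ^ 2 := by
  obtain ⟨k, hk, hkt⟩ := hδ.exists_crossing hε hε1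
  have hsub : uIcc ε 1 ⊆ uIcc 0 1 := by
    rw [uIcc_of_le hε1, uIcc_of_le zero_le_one]
    exact Icc_subset_Icc_left hε.le
  have hD : AbsolutelyContinuousOnInterval δ ε 1 := hδ.absolutelyContinuousOnInterval.mono hsub
  have hI : AbsolutelyContinuousOnInterval (fun t : ℝ => t) ε 1 :=
    contDiffOn_id.absolutelyContinuousOnInterval
  have hG : AbsolutelyContinuousOnInterval (fun t => δ t / t) ε 1 := by
    have hinv : AbsolutelyContinuousOnInterval (fun t : ℝ => t⁻¹) ε 1 := by
      refine ContDiffOn.absolutelyContinuousOnInterval (contDiffOn_id.inv fun t ht => ?_)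
      rw [uIcc_of_le hε1] at ht
      exact (hε.trans_le ht.1).ne'
    exact hD.mul hinv
  let H : ℝ → ℝ := fun t => (δ t * δ t - 3 / 2 * (t * δ t) + 1 / 2 * (t * t))
    - k / 2 * ((δ t / t) * ((δ t / t) * ((δ t / t) * (δ t / t)))
      - (δ t / t) * ((δ t / t) * (δ t / t)))
  have hH : AbsolutelyContinuousOnInterval H ε 1 :=
    (((hD.mul hD).sub ((hI.mul hD).const_mul _)).add ((hI.mul hI).const_mul _)).sub
      (((hG.mul (hG.mul (hG.mul hG))).sub (hG.mul (hG.mul hG))).const_mul _)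
  have hint : IntervalIntegrable (fun t => 2 * (δ t ^ 2 / t) - 3 * δ t + t) volume ε 1 :=
    (((hδ.intervalIntegrable_sq_div.const_mul 2).sub (hδ.intervalIntegrable.const_mul 3)).add
      intervalIntegral.intervalIntegrable_id).mono_set hsub
  have hle : ∫ t in ε..1, (2 * (δ t ^ 2 / t) - 3 * δ t + t) ≤ ∫ t in ε..1, deriv H t := by
    refine intervalIntegral.integral_mono_ae_restrict hε1 hint hH.intervalIntegrable_deriv ?_
    rw [Filter.EventuallyLE, ← Measure.restrict_congr_set Ioo_ae_eq_Icc,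
      ae_restrict_iff' measurableSet_Ioo]
    filter_upwards [hδ.ae_differentiableAt] with t hd ht
    have ht0 : 0 < t := hε.trans ht.1
    have ht' : t ∈ Ioo (0:ℝ) 1 := ⟨ht0, ht.2⟩
    have hd := (hd (Ioo_subset_Icc_self ht')).hasDerivAt
    set d := deriv δ t
    have hi := hasDerivAt_id' t
    have hg : HasDerivAt (fun t => δ t / t) ((d * t - δ t * 1) / t ^ 2) t := hd.div hi ht0.ne'
    have hg0 : 0 ≤ (d * t - δ t * 1) / t ^ 2 :=
      div_nonneg (by linarith [hδ.le_mul_deriv ht' hd]) (sq_nonneg t)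
    have hderiv := (((hd.mul hd).sub ((hi.mul hd).const_mul (3 / 2))).add
      ((hi.mul hi).const_mul (1 / 2))).sub
      (((hg.mul (hg.mul (hg.mul hg))).sub (hg.mul (hg.mul hg))).const_mul (k / 2))
    have hHd : deriv H t = _ := hderiv.deriv
    have key := mul_nonneg hg0 (hkt t (Ioo_subset_Icc_self ht))
    rw [hHd, ← sub_nonneg]
    refine (mul_nonneg (one_half_pos (α := ℝ)).le key).trans_eq ?_
    simp only [Pi.mul_apply]
    field_simp
    ring
  refine hle.trans ?_
  rw [hH.integral_deriv_eq_sub]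
  obtain ⟨hl, hu⟩ := hδ.2.2.2.1 ε ⟨hε.le, hε1⟩
  have hg0 : 0 ≤ δ ε / ε := div_nonneg ((sq_nonneg ε).trans hl) hε.le
  have hg1 : δ ε / ε ≤ 1 := (div_le_one hε).2 hu
  have hδε : δ ε = ε * (δ ε / ε) := by field_simp
  have h1 : H 1 = 0 := by
    simp only [H, hδ.2.2.1]
    norm_num
  have hk3 : 0 ≤ k * ((δ ε / ε) ^ 3 * (1 - δ ε / ε)) :=
    mul_nonneg hk (mul_nonneg (pow_nonneg hg0 3) (sub_nonneg.2 hg1))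
  have h2 : H ε = ε ^ 2 * ((δ ε / ε) ^ 2 - 3 / 2 * (δ ε / ε) + 1 / 2)
      + 1 / 2 * (k * ((δ ε / ε) ^ 3 * (1 - δ ε / ε))) := by
    simp only [H]
    field_simp
    ring
  rw [h1, h2]
  nlinarith [mul_nonneg (sq_nonneg ε) (sq_nonneg (δ ε / ε - 3 / 4)), sq_nonneg ε]

theorem integral_nonpos (hδ : IsLSL δ) :
    ∫ t in (0:ℝ)..1, (2 * (δ t ^ 2 / t) - 3 * δ t + t) ≤ 0 := by
  have hint : IntervalIntegrable (fun t => 2 * (δ t ^ 2 / t) - 3 * δ t + t) volume 0 1 :=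
    ((hδ.intervalIntegrable_sq_div.const_mul 2).sub (hδ.intervalIntegrable.const_mul 3)).add
      intervalIntegral.intervalIntegrable_id
  have hbound : ∀ ε : ℝ, 0 < ε → ε ≤ 1 →
      ∫ t in (0:ℝ)..1, (2 * (δ t ^ 2 / t) - 3 * δ t + t) ≤ 2 * ε ^ 2 := by
    intro ε hε hε1
    have hmem : ε ∈ uIcc (0:ℝ) 1 := by
      rw [uIcc_of_le zero_le_one]
      exact ⟨hε.le, hε1⟩
    have hint0 := hint.mono_set (uIcc_subset_uIcc_left hmem)
    have hint1 := hint.mono_set (uIcc_subset_uIcc_right hmem)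
    rw [← intervalIntegral.integral_add_adjacent_intervals hint0 hint1]
    have h0 : ∫ t in (0:ℝ)..ε, (2 * (δ t ^ 2 / t) - 3 * δ t + t) ≤ ∫ _ in (0:ℝ)..ε, ε := by
      refine intervalIntegral.integral_mono_on_of_le_Ioo hε.le hint0 (by simp) fun t ht => ?_
      obtain ⟨hl, hu⟩ := hδ.2.2.2.1 t ⟨ht.1.le, ht.2.le.trans hε1⟩
      have hδ0 : 0 ≤ δ t := (sq_nonneg t).trans hl
      have : δ t ^ 2 / t ≤ δ t := (div_le_iff₀ ht.1).2 (by nlinarith)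
      linarith [ht.2]
    rw [intervalIntegral.integral_const] at h0
    simp only [sub_zero, smul_eq_mul] at h0
    linarith [hδ.integral_le_sq hε hε1]
  refine le_of_forall_pos_le_add fun η hη => ?_
  have hm : 0 < min 1 (η / 2) := lt_min one_pos (half_pos hη)
  have h1 := min_le_left 1 (η / 2)
  have h2 := min_le_right 1 (η / 2)
  nlinarith [hbound _ hm h1]

theorem tauLSL_le_phiLSL (hδ : IsLSL δ) : tauLSL δ ≤ phiLSL δ := by
  have h := hδ.integral_nonpos
  have h1 := hδ.intervalIntegrable_sq_div.const_mul 2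
  have h2 := hδ.intervalIntegrable.const_mul 3
  rw [intervalIntegral.integral_add (h1.sub h2) intervalIntegral.intervalIntegrable_id,
    intervalIntegral.integral_sub h1 h2, intervalIntegral.integral_const_mul,
    intervalIntegral.integral_const_mul, integral_id] at h
  unfold tauLSL phiLSL
  linarith

end IsLSL

/-- For every lower semilinear diagonal, Chatterjee's rank correlation never exceeds
Spearman's footrule. -/
theorem xi_le_phi (δ : ℝ → ℝ) (hδ : IsLSL δ) : xiLSL δ ≤ phiLSL δ := by
  exact hδ.xiLSL_le_tauLSL.trans hδ.tauLSL_le_phiLSL
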